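/- Let T̂ ⊂ ℝ² be the reference triangle and P_p(T̂) the space of polynomials of total degree at most p. Define, for ŵ ∈ P_p(T̂), the quantity ‖ŵ‖_* := sup_{v̂ ∈ (P_p(T̂))², v̂ ≠ 0} |∫_{T̂} ŵ div v̂| / ‖v̂‖_{L²(T̂)} + ‖ŵ‖_{L²(∂T̂)}. Then ‖·‖_* is a norm on P_p(T̂); in particular, if ‖ŵ‖_* = 0 then ŵ = 0. -/

import Mathlib

open MeasureTheory MvPolynomial

noncomputable section

/-- The reference triangle `T̂ = {x : 0 ≤ x₀, 0 ≤ x₁, x₀ + x₁ ≤ 1} ⊂ ℝ²`. -/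
def Tref : Set (Fin 2 → ℝ) := {x | 0 ≤ x 0 ∧ 0 ≤ x 1 ∧ x 0 + x 1 ≤ 1}

/-- Divergence of a polynomial vector field. -/
def divP (v : Fin 2 → MvPolynomial (Fin 2) ℝ) : MvPolynomial (Fin 2) ℝ :=
  pderiv 0 (v 0) + pderiv 1 (v 1)

/-- The `L²(∂T̂)` norm of a polynomial: sum of squared line integrals over the three
edges of the reference triangle (with arc-length factor `√2` on the hypotenuse). -/
def bdryNorm (w : MvPolynomial (Fin 2) ℝ) : ℝ :=
  Real.sqrt ((∫ t in (0:ℝ)..1, (eval ![t, 0] w) ^ 2) +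
    (∫ t in (0:ℝ)..1, (eval ![(0:ℝ), t] w) ^ 2) +
    Real.sqrt 2 * ∫ t in (0:ℝ)..1, (eval ![t, 1 - t] w) ^ 2)

/-- The sup term `sup_{v̂ ∈ (P_p)², v̂ ≠ 0} |∫_{T̂} ŵ div v̂| / ‖v̂‖_{L²(T̂)}`. -/
def supTerm (p : ℕ) (w : MvPolynomial (Fin 2) ℝ) : ℝ :=
  sSup {r : ℝ | ∃ v : Fin 2 → MvPolynomial (Fin 2) ℝ,
    (∀ i, (v i).totalDegree ≤ p) ∧ v ≠ 0 ∧
    r = |∫ x in Tref, eval x w * eval x (divP v)| /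
      Real.sqrt (∫ x in Tref, ((eval x (v 0)) ^ 2 + (eval x (v 1)) ^ 2))}

/-- The quantity `‖ŵ‖_* = sup term + ‖ŵ‖_{L²(∂T̂)}`. -/
def starNorm (p : ℕ) (w : MvPolynomial (Fin 2) ℝ) : ℝ := supTerm p w + bdryNorm w

lemma cont_eval (q : MvPolynomial (Fin 2) ℝ) : Continuous fun x : Fin 2 → ℝ => eval x q :=
  MvPolynomial.continuous_eval q

lemma Tref_closed : IsClosed Tref := by
  have h : Tref = {x : Fin 2 → ℝ | 0 ≤ x 0} ∩ ({x | 0 ≤ x 1} ∩ {x | x 0 + x 1 ≤ 1}) := rfl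
  rw [h]
  refine (isClosed_le (by fun_prop) (by fun_prop)).inter
    ((isClosed_le (by fun_prop) (by fun_prop)).inter (isClosed_le (by fun_prop) (by fun_prop)))

lemma Tref_compact : IsCompact Tref := by
  refine (isCompact_Icc (a := (0 : Fin 2 → ℝ)) (b := 1)).of_isClosed_subset Tref_closed ?_
  rintro x ⟨h0, h1, h2⟩
  constructor
  · intro i
    fin_cases i
    · exact h0
    · exact h1
  · intro i
    fin_cases i
    · show x 0 ≤ 1
      linarith
    · show x 1 ≤ 1
      linarith

lemma intOn (q : MvPolynomial (Fin 2) ℝ) : IntegrableOn (fun x => eval x q) Tref :=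
  (cont_eval q).continuousOn.integrableOn_compact Tref_compact

/-- Integration over the triangle. -/
def IT : MvPolynomial (Fin 2) ℝ →ₗ[ℝ] ℝ where
  toFun q := ∫ x in Tref, eval x q
  map_add' a b := by
    simp only [map_add]
    exact integral_add (intOn a) (intOn b)
  map_smul' c a := by
    simp only [smul_eval, RingHom.id_apply, smul_eq_mul]
    exact integral_const_mul _ _

/-- Integration along a curve. -/
def IE (g : ℝ → Fin 2 → ℝ) (hg : Continuous g) : MvPolynomial (Fin 2) ℝ →ₗ[ℝ] ℝ where
  toFun q := ∫ t in (0:ℝ)..1, eval (g t) q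
  map_add' a b := by
    simp only [map_add]
    exact intervalIntegral.integral_add (((cont_eval a).comp hg).intervalIntegrable _ _)
      (((cont_eval b).comp hg).intervalIntegrable _ _)
  map_smul' c a := by
    simp only [smul_eval, RingHom.id_apply, smul_eq_mul]
    exact intervalIntegral.integral_const_mul _ _

lemma IE_nonneg (g hg) (w : MvPolynomial (Fin 2) ℝ) : 0 ≤ IE g hg (w * w) := by
  refine intervalIntegral.integral_nonneg (by norm_num) fun t _ => ?_
  rw [map_mul]
  exact mul_self_nonneg _

lemma g1 : Continuous fun t : ℝ => (![t, 0] : Fin 2 → ℝ) := by fun_prop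
lemma g2 : Continuous fun t : ℝ => (![0, t] : Fin 2 → ℝ) := by fun_prop
lemma g3 : Continuous fun t : ℝ => (![t, 1 - t] : Fin 2 → ℝ) := by fun_prop

/-- Integration over the boundary. -/
def IB : MvPolynomial (Fin 2) ℝ →ₗ[ℝ] ℝ := IE _ g1 + IE _ g2 + Real.sqrt 2 • IE _ g3

lemma IB_nonneg (w : MvPolynomial (Fin 2) ℝ) : 0 ≤ IB (w * w) :=
  add_nonneg (add_nonneg (IE_nonneg _ _ _) (IE_nonneg _ _ _))
    (mul_nonneg (Real.sqrt_nonneg _) (IE_nonneg _ _ _))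

lemma bdry_eq (w : MvPolynomial (Fin 2) ℝ) : bdryNorm w = Real.sqrt (IB (w * w)) := by
  simp [bdryNorm, IB, IE, sq]

lemma bdry_smul (c : ℝ) (w : MvPolynomial (Fin 2) ℝ) : bdryNorm (c • w) = |c| * bdryNorm w := by
  rw [bdry_eq, bdry_eq, smul_mul_smul_comm, map_smul, smul_eq_mul,
    Real.sqrt_mul (mul_self_nonneg c), Real.sqrt_mul_self_eq_abs]

/-- Bilinear form. -/
def BB : LinearMap.BilinForm ℝ (MvPolynomial (Fin 2) ℝ) :=
  (LinearMap.mul ℝ (MvPolynomial (Fin 2) ℝ)).compr₂ IB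

lemma bdry_add (w u : MvPolynomial (Fin 2) ℝ) : bdryNorm (w + u) ≤ bdryNorm w + bdryNorm u := by
  have hcs : (IB (w * u)) ^ 2 ≤ IB (w * w) * IB (u * u) :=
    LinearMap.BilinForm.apply_sq_le_of_symm BB IB_nonneg
      ⟨fun x y => by simp [BB, mul_comm]⟩ w u
  simp only [bdry_eq]
  have hw := IB_nonneg w
  have hu := IB_nonneg u
  apply Real.sqrt_le_iff.2
  refine ⟨by positivity, ?_⟩
  have e : IB ((w + u) * (w + u)) = IB (w * w) + 2 * IB (w * u) + IB (u * u) := by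
    rw [show (w + u) * (w + u) = w * w + (w * u + w * u) + u * u by ring]
    simp only [map_add]
    ring
  have h2 : IB (w * u) ≤ Real.sqrt (IB (w * w)) * Real.sqrt (IB (u * u)) := by
    rw [← Real.sqrt_mul hw]
    exact Real.le_sqrt_of_sq_le hcs
  rw [e, add_sq, Real.sq_sqrt hw, Real.sq_sqrt hu]
  linarith

lemma zero_of_IT (f q : MvPolynomial (Fin 2) ℝ) (hf : ∀ x ∈ Tref, 0 ≤ eval x f)
    (hi : IT f = 0)
    (h : ∀ x : Fin 2 → ℝ, 0 < x 0 → 0 < x 1 → eval x f = 0 → eval x q = 0) : q = 0 := by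
  have h1 : (fun x => eval x f) =ᵐ[volume.restrict Tref] 0 := by
    refine (setIntegral_eq_zero_iff_of_nonneg_ae ?_ (intOn f)).1 hi
    exact (ae_restrict_iff' Tref_closed.measurableSet).2 (Filter.Eventually.of_forall hf)
  let U : Set (Fin 2 → ℝ) := Set.pi Set.univ fun _ => Set.Ioo (0:ℝ) (1/2)
  have hU : IsOpen U := isOpen_set_pi Set.finite_univ fun _ _ => isOpen_Ioo
  have hUT : U ⊆ Tref := by
    intro x hx
    have a := hx 0 trivial
    have b := hx 1 trivial
    simp only [Set.mem_Ioo] at a b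
    exact ⟨a.1.le, b.1.le, by linarith [a.2, b.2]⟩
  have h2 := Measure.eqOn_open_of_ae_eq (ae_restrict_of_ae_restrict_of_subset hUT h1) hU
    (cont_eval f).continuousOn continuousOn_const
  refine MvPolynomial.funext_set (fun _ => Set.Ioo (0:ℝ) (1/2))
    (fun _ => Set.Ioo_infinite (by norm_num)) fun x hx => ?_
  rw [map_zero]
  exact h x (hx 0 trivial).1 (hx 1 trivial).1 (h2 hx)

/-- The space of test fields. -/
abbrev VV (p : ℕ) := Fin 2 → restrictTotalDegree (Fin 2) ℝ p

/-- The inner product on test fields. -/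
@[reducible]
def core (p : ℕ) : InnerProductSpace.Core ℝ (VV p) where
  inner v u := IT ((v 0 : MvPolynomial (Fin 2) ℝ) * u 0 + (v 1 : MvPolynomial (Fin 2) ℝ) * u 1)
  conj_inner_symm v u := by simp [mul_comm]
  re_inner_nonneg v := by
    refine integral_nonneg fun x => ?_
    simp only [map_add, map_mul]
    exact add_nonneg (mul_self_nonneg _) (mul_self_nonneg _)
  add_left a b c := by
    simp only [← map_add]
    congr 1
    simp only [Pi.add_apply, Submodule.coe_add]
    ring
  smul_left a b r := by
    simp only [Pi.smul_apply, Submodule.coe_smul, smul_mul_assoc, ← smul_add, map_smul]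
    simp
  definite v hv := by
    have hx : ∀ x ∈ Tref, 0 ≤ eval x
        ((v 0 : MvPolynomial (Fin 2) ℝ) * v 0 + (v 1 : MvPolynomial (Fin 2) ℝ) * v 1) := by
      intro x _
      simp only [map_add, map_mul]
      exact add_nonneg (mul_self_nonneg _) (mul_self_nonneg _)
    funext i
    apply Subtype.ext
    refine zero_of_IT _ _ hx hv fun x _ _ h => ?_
    simp only [map_add, map_mul] at h
    fin_cases i
    · show eval x (v 0 : MvPolynomial (Fin 2) ℝ) = 0
      nlinarith
    · show eval x (v 1 : MvPolynomial (Fin 2) ℝ) = 0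
      nlinarith

lemma core_bound {V : Type*} [AddCommGroup V] [Module ℝ V] [Module.Finite ℝ V]
    (c : InnerProductSpace.Core ℝ V) (f : V →ₗ[ℝ] ℝ) :
    ∃ C : ℝ, 0 ≤ C ∧ ∀ v, |f v| ≤ C * Real.sqrt (c.inner v v) := by
  letI := c.toNormedAddCommGroup
  letI : InnerProductSpace ℝ V := InnerProductSpace.ofCore c.toCore
  refine ⟨‖f.toContinuousLinearMap‖, ContinuousLinearMap.opNorm_nonneg _, fun v => ?_⟩
  exact f.toContinuousLinearMap.le_opNorm v

/-- The functional whose dual norm is the sup term. -/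
def FF (p : ℕ) (w : MvPolynomial (Fin 2) ℝ) : VV p →ₗ[ℝ] ℝ where
  toFun v := IT (w * divP fun i => v i)
  map_add' a b := by
    rw [← map_add]
    congr 1
    simp only [divP, Pi.add_apply, Submodule.coe_add, map_add]
    ring
  map_smul' c a := by
    rw [RingHom.id_apply, ← map_smul]
    congr 1
    simp only [divP, Pi.smul_apply, Submodule.coe_smul, Derivation.map_smul, ← smul_add, mul_smul_comm]

/-- The set of quotients. -/
def SS (p : ℕ) (w : MvPolynomial (Fin 2) ℝ) : Set ℝ :=
  {r : ℝ | ∃ v : Fin 2 → MvPolynomial (Fin 2) ℝ,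
    (∀ i, (v i).totalDegree ≤ p) ∧ v ≠ 0 ∧
    r = |IT (w * divP v)| / Real.sqrt (IT (v 0 * v 0 + v 1 * v 1))}

lemma sup_eq (p : ℕ) (w : MvPolynomial (Fin 2) ℝ) : supTerm p w = sSup (SS p w) := by
  simp [supTerm, SS, IT, sq]

lemma SS_bound (p : ℕ) (w : MvPolynomial (Fin 2) ℝ) : BddAbove (SS p w) := by
  obtain ⟨C, hC, h⟩ := core_bound (core p) (FF p w)
  refine ⟨C, ?_⟩
  rintro r ⟨v, hv, -, rfl⟩
  refine div_le_of_le_mul₀ (Real.sqrt_nonneg _) hC ?_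
  exact h fun i => ⟨v i, (mem_restrictTotalDegree _ _ _).2 (hv i)⟩

lemma SS_nonempty (p : ℕ) (w : MvPolynomial (Fin 2) ℝ) : (SS p w).Nonempty :=
  ⟨_, fun _ => 1, fun _ => by simp, fun h => one_ne_zero (congrFun h 0), rfl⟩

lemma SS_nonneg (p : ℕ) (w : MvPolynomial (Fin 2) ℝ) : ∀ r ∈ SS p w, 0 ≤ r := by
  rintro r ⟨v, -, -, rfl⟩
  positivity

lemma sup_nonneg (p : ℕ) (w : MvPolynomial (Fin 2) ℝ) : 0 ≤ supTerm p w := by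
  rw [sup_eq]
  exact Real.sSup_nonneg (SS_nonneg p w)

lemma sup_smul (p : ℕ) (c : ℝ) (w : MvPolynomial (Fin 2) ℝ) :
    supTerm p (c • w) = |c| * supTerm p w := by
  rw [sup_eq, sup_eq, ← smul_eq_mul, ← Real.sSup_smul_of_nonneg (abs_nonneg c)]
  congr 1
  ext r
  rw [Set.mem_smul_set]
  constructor
  · rintro ⟨v, h1, h2, rfl⟩
    refine ⟨_, ⟨v, h1, h2, rfl⟩, ?_⟩
    rw [smul_mul_assoc, map_smul, smul_eq_mul, smul_eq_mul, abs_mul, mul_div_assoc]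
  · rintro ⟨_, ⟨v, h1, h2, rfl⟩, rfl⟩
    refine ⟨v, h1, h2, ?_⟩
    rw [smul_mul_assoc, map_smul, smul_eq_mul, smul_eq_mul, abs_mul, mul_div_assoc]

lemma supTerm_add (p : ℕ) (w u : MvPolynomial (Fin 2) ℝ) :
    supTerm p (w + u) ≤ supTerm p w + supTerm p u := by
  simp only [sup_eq]
  refine csSup_le (SS_nonempty p _) ?_
  rintro r ⟨v, h1, h2, rfl⟩
  refine le_trans ?_ (add_le_add (le_csSup (SS_bound p w) ⟨v, h1, h2, rfl⟩)
    (le_csSup (SS_bound p u) ⟨v, h1, h2, rfl⟩))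
  rw [← add_div, add_mul, map_add]
  gcongr
  exact abs_add_le _ _

lemma X_dvd_of_edge (w : MvPolynomial (Fin 2) ℝ) (h : ∀ t ∈ Set.Ioo (0:ℝ) 1, eval ![t, 0] w = 0) :
    X 1 ∣ w := by
  let φ : MvPolynomial (Fin 2) ℝ →ₐ[ℝ] MvPolynomial (Fin 2) ℝ := aeval ![X 0, 0]
  have h1 : φ w = 0 := by
    refine MvPolynomial.funext_set (fun _ => Set.Ioo (0:ℝ) 1)
      (fun _ => Set.Ioo_infinite (by norm_num)) fun x hx => ?_
    rw [map_zero, ← h (x 0) (hx 0 trivial)]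
    have e : (aeval x : MvPolynomial (Fin 2) ℝ →ₐ[ℝ] ℝ).comp φ = aeval ![x 0, 0] := by
      ext i
      fin_cases i <;> simp [φ]
    have := DFunLike.congr_fun e w
    simpa [aeval_eq_eval] using this
  have h2 : ∀ q : MvPolynomial (Fin 2) ℝ, X 1 ∣ q - φ q := by
    intro q
    induction q using MvPolynomial.induction_on with
    | C a => simp [φ]
    | add a b ha hb =>
      rw [map_add, add_sub_add_comm]
      exact dvd_add ha hb
    | mul_X a i ha =>
      rw [map_mul, show a * X i - φ a * φ (X i) = (a - φ a) * X i + φ a * (X i - φ (X i)) by ring]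
      refine dvd_add (ha.mul_right _) (Dvd.dvd.mul_left ?_ _)
      fin_cases i <;> simp [φ]
  simpa [h1] using h2 w

lemma antideriv (u : MvPolynomial (Fin 2) ℝ) :
    ∃ v : MvPolynomial (Fin 2) ℝ, v.totalDegree ≤ u.totalDegree + 1 ∧ pderiv 0 v = u := by
  refine ⟨∑ m ∈ u.support, monomial (m + Finsupp.single 0 1) (coeff m u / (m 0 + 1)), ?_, ?_⟩
  · refine totalDegree_finsetSum_le fun m hm => ?_
    refine (totalDegree_monomial_le _ _).trans ?_
    have := le_totalDegree hm
    rw [Finsupp.sum_fintype _ _ (fun _ => rfl)] at this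
    have e : (m + Finsupp.single 0 1).degree = (∑ i, m i) + 1 := by
      simp [Finsupp.degree_eq_sum]
      omega
    first
      | exact e.le.trans (Nat.succ_le_succ this)
      | (rw [Finsupp.sum_fintype _ _ (fun _ => rfl)]; simp at *; omega)
  · conv_rhs => rw [u.as_sum]
    rw [map_sum]
    refine Finset.sum_congr rfl fun m _ => ?_
    rw [pderiv_monomial, add_tsub_cancel_right]
    congr 1
    have : (m 0 : ℝ) + 1 ≠ 0 := by positivity
    simp
    field_simp

lemma edge_zero (w : MvPolynomial (Fin 2) ℝ) (h : bdryNorm w = 0) :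
    ∀ t ∈ Set.Ioo (0:ℝ) 1, eval ![t, 0] w = 0 := by
  rw [bdry_eq, Real.sqrt_eq_zero (IB_nonneg w)] at h
  have a1 := IE_nonneg _ g1 w
  have a2 := IE_nonneg _ g2 w
  have a3 : 0 ≤ Real.sqrt 2 * IE _ g3 (w * w) :=
    mul_nonneg (Real.sqrt_nonneg _) (IE_nonneg _ g3 w)
  have h' : IE _ g1 (w * w) + IE _ g2 (w * w) + Real.sqrt 2 * IE _ g3 (w * w) = 0 := h
  have h0 : ∫ t in (0:ℝ)..1, eval ![t, 0] (w * w) = 0 := by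
    have : IE _ g1 (w * w) = 0 := by linarith
    exact this
  have hc : Continuous fun t : ℝ => eval ![t, 0] (w * w) := (cont_eval (w * w)).comp g1
  rw [intervalIntegral.integral_of_le (by norm_num)] at h0
  have h1 := (setIntegral_eq_zero_iff_of_nonneg_ae (Filter.Eventually.of_forall fun t => by
    simp only [map_mul]
    exact mul_self_nonneg _) (hc.integrableOn_Ioc)).1 h0
  have h2 := Measure.eqOn_open_of_ae_eq
    (ae_restrict_of_ae_restrict_of_subset Set.Ioo_subset_Ioc_self h1) isOpen_Ioo
    hc.continuousOn continuousOn_const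
  intro t ht
  have := h2 ht
  simpa using this

lemma definite_star (p : ℕ) (w : MvPolynomial (Fin 2) ℝ) (hw : w.totalDegree ≤ p)
    (h : starNorm p w = 0) : w = 0 := by
  have hb : 0 ≤ bdryNorm w := Real.sqrt_nonneg _
  have hs := sup_nonneg p w
  have hb0 : bdryNorm w = 0 := by
    unfold starNorm at h
    linarith
  have hs0 : supTerm p w = 0 := by
    unfold starNorm at h
    linarith
  obtain ⟨u, rfl⟩ := X_dvd_of_edge w (edge_zero w hb0)
  by_contra hne
  have hu : u ≠ 0 := right_ne_zero_of_mul hne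
  rw [totalDegree_mul_of_isDomain (X_ne_zero 1) hu, totalDegree_X] at hw
  obtain ⟨v, hv, rfl⟩ := antideriv u
  have hv0 : v ≠ 0 := by
    rintro rfl
    simp at hu
  let V : VV p := ![⟨v, (mem_restrictTotalDegree _ _ _).2 (by omega)⟩, 0]
  obtain ⟨C, hC, hbd⟩ := core_bound (core p) (FF p (X 1 * pderiv 0 v))
  have hpos : 0 < IT (v * v) := by
    have h0 : 0 ≤ IT (v * v) := integral_nonneg fun x => by
      simp only [map_mul]
      exact mul_self_nonneg _
    refine lt_of_le_of_ne h0 fun he => hv0 ?_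
    refine zero_of_IT (v * v) v (fun x _ => ?_) he.symm fun x _ _ hx => ?_
    · rw [map_mul]
      exact mul_self_nonneg _
    · simpa using hx
  have hmem : |IT (X 1 * pderiv 0 v * pderiv 0 v)| / Real.sqrt (IT (v * v)) ∈
      SS p (X 1 * pderiv 0 v) := by
    refine ⟨![v, 0], fun i => ?_, fun hh => hv0 (congrFun hh 0), by simp [divP]⟩
    fin_cases i
    · show v.totalDegree ≤ p
      omega
    · simp
  have hle := le_csSup (SS_bound p _) hmem
  rw [← sup_eq, hs0] at hle
  have hz : |IT (X 1 * pderiv 0 v * pderiv 0 v)| ≤ 0 := by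
    have := (div_le_iff₀ (Real.sqrt_pos.2 hpos)).1 hle
    simpa using this
  have hz' := abs_nonpos_iff.1 hz
  refine hu (zero_of_IT _ _ (fun x hx => ?_) hz' fun x _ h1 hx => ?_)
  · rw [mul_assoc]
    simp only [map_mul, eval_X]
    exact mul_nonneg hx.2.1 (mul_self_nonneg _)
  · simp only [map_mul, eval_X] at hx
    simpa [h1.ne'] using hx

/-- `‖·‖_*` is a norm on `P_p(T̂)`: it is definite (in particular
`‖ŵ‖_* = 0` forces `ŵ = 0`), absolutely homogeneous, subadditive and nonnegative. -/
theorem stmt6 (p : ℕ) :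
    (∀ w : MvPolynomial (Fin 2) ℝ, w.totalDegree ≤ p → starNorm p w = 0 → w = 0) ∧
    (∀ (c : ℝ) (w : MvPolynomial (Fin 2) ℝ), w.totalDegree ≤ p →
      starNorm p (c • w) = |c| * starNorm p w) ∧
    (∀ w u : MvPolynomial (Fin 2) ℝ, w.totalDegree ≤ p → u.totalDegree ≤ p →
      starNorm p (w + u) ≤ starNorm p w + starNorm p u) ∧
    (∀ w : MvPolynomial (Fin 2) ℝ, w.totalDegree ≤ p → 0 ≤ starNorm p w) := by
  refine ⟨definite_star p, fun c w _ => ?_, fun w u _ _ => ?_, fun w _ => ?_⟩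
  · unfold starNorm
    rw [sup_smul, bdry_smul]
    ring
  · unfold starNorm
    linarith [supTerm_add p w u, bdry_add w u]
  · exact add_nonneg (sup_nonneg p w) (Real.sqrt_nonneg _)

end
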